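/- arXiv:1212.4004 — 6 statements merged into one kernel-verified Lean document; each statement's English description precedes it below -/
import Mathlib

section
/- There exists a constant C>0 (depending only on d0 and L) such that for every α>0 the Lebesgue measure of the sublevel set {s∈(0,L) : |D(s)|<α} is at most C·min(α,1). -/
open MeasureTheory Set

/-- A function bounded below by `δ` almost everywhere on `(a, b)` has integral at least
`δ * (y - x)` over each `[x, y] ⊆ [a, b]`. -/
theorem mul_sub_le_intervalIntegral_of_ae_le {f : ℝ → ℝ} {δ a b x y : ℝ}
    (hf : IntervalIntegrable f volume x y) (hax : a ≤ x) (hxy : x ≤ y) (hyb : y ≤ b)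
    (h : ∀ᵐ s ∂(volume.restrict (Ioo a b)), δ ≤ f s) :
    δ * (y - x) ≤ ∫ t in x..y, f t := by
  have hle : ∫ _ in x..y, δ ≤ ∫ t in x..y, f t := by
    refine intervalIntegral.integral_mono_ae_restrict hxy intervalIntegrable_const hf ?_
    rw [← Measure.restrict_congr_set (Ioo_ae_eq_Icc (μ := volume) (a := x) (b := y))]
    exact ae_restrict_of_ae_restrict_of_subset (Ioo_subset_Ioo hax hyb) h
  simpa [mul_comm] using hle

/-- A function bounded away from zero with constant sign almost everywhere on `(a, b)` has
integral at least `δ * (y - x)` in absolute value over each `[x, y] ⊆ [a, b]`. -/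
theorem mul_sub_le_abs_intervalIntegral_of_ae {f : ℝ → ℝ} {δ a b x y : ℝ}
    (hf : IntervalIntegrable f volume x y) (hax : a ≤ x) (hxy : x ≤ y) (hyb : y ≤ b)
    (h : (∀ᵐ s ∂(volume.restrict (Ioo a b)), δ ≤ f s) ∨
      (∀ᵐ s ∂(volume.restrict (Ioo a b)), f s ≤ -δ)) :
    δ * (y - x) ≤ |∫ t in x..y, f t| := by
  rcases h with h | h
  · exact (mul_sub_le_intervalIntegral_of_ae_le hf hax hxy hyb h).trans (le_abs_self _)
  · have hneg : δ * (y - x) ≤ ∫ t in x..y, -f t :=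
      mul_sub_le_intervalIntegral_of_ae_le hf.neg hax hxy hyb
        (h.mono fun s hs => le_neg_of_le_neg hs)
    rw [intervalIntegral.integral_neg] at hneg
    exact hneg.trans (neg_le_abs _)

/-- If `F` expands distances on `s` by a factor at least `δ`, then the part of `s` where
`|F| < α` has measure at most `2 * α / δ`. -/
theorem volume_abs_lt_le_of_expanding {F : ℝ → ℝ} {s : Set ℝ} {δ α : ℝ} (hδ : 0 < δ)
    (hF : ∀ x ∈ s, ∀ y ∈ s, x ≤ y → δ * (y - x) ≤ |F y - F x|) :
    volume {x ∈ s | |F x| < α} ≤ ENNReal.ofReal (2 * α / δ) := by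
  have key : ∀ x ∈ {x ∈ s | |F x| < α}, ∀ y ∈ {x ∈ s | |F x| < α}, x ≤ y →
      y - x ≤ 2 * α / δ := by
    rintro x ⟨hx, hxα⟩ y ⟨hy, hyα⟩ hxy
    rw [le_div_iff₀ hδ]
    linarith [hF x hx y hy hxy, abs_sub (F y) (F x)]
  refine (Real.volume_le_diam _).trans (Metric.ediam_le fun x hx y hy => ?_)
  rw [edist_dist, Real.dist_eq]
  refine ENNReal.ofReal_le_ofReal ?_
  rcases le_total x y with hxy | hxy
  · rw [abs_sub_comm, abs_of_nonneg (sub_nonneg.2 hxy)]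
    exact key x hx y hy hxy
  · rw [abs_of_nonneg (sub_nonneg.2 hxy)]
    exact key y hy x hx hxy

/-- Sublevel set estimate: if `d0` is bounded away from zero and changes sign
finitely many times on `[0, L]`, then the measure of the sublevel set
`{s ∈ (0, L) | |D s| < α}` is at most `C · min α 1`. -/
theorem sublevel_set_estimate
    (L : ℝ) (hL : 0 < L) (d0 : ℝ → ℝ)
    (hd0int : IntegrableOn d0 (Icc 0 L))
    (D : ℝ → ℝ) (hD : ∀ s, D s = ∫ t in (0:ℝ)..s, d0 t)
    (hpw : ∃ δ > (0:ℝ), ∃ N : ℕ, 0 < N ∧ ∃ c : ℕ → ℝ,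
      c 0 = 0 ∧ c N = L ∧ (∀ j < N, c j < c (j + 1)) ∧
      (∀ j < N,
        (∀ᵐ s ∂(volume.restrict (Ioo (c j) (c (j + 1)))), δ ≤ d0 s) ∨
        (∀ᵐ s ∂(volume.restrict (Ioo (c j) (c (j + 1)))), d0 s ≤ -δ))) :
    ∃ C > (0:ℝ), ∀ α > (0:ℝ),
      volume {s ∈ Ioo (0:ℝ) L | |D s| < α} ≤ ENNReal.ofReal (C * min α 1) := by
  obtain ⟨δ, hδ, N, -, c, hc0, hcN, hc, hsign⟩ := hpw
  have hmono : ∀ i j, i ≤ j → j ≤ N → c i ≤ c j := fun i j hij =>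
    Nat.le_induction (fun _ => le_rfl)
      (fun k _ ih hk => (ih (by lia)).trans (hc k (by lia)).le) j hij
  have hint : ∀ x ∈ Icc 0 L, ∀ y ∈ Icc 0 L, IntervalIntegrable d0 volume x y :=
    fun x hx y hy => (hd0int.mono_set (uIcc_subset_Icc hx hy)).intervalIntegrable
  have hpiece : ∀ α, ∀ j < N, volume {s ∈ Ioc (c j) (c (j + 1)) | |D s| < α} ≤
      ENNReal.ofReal (2 * α / δ) := by
    intro α j hj
    refine volume_abs_lt_le_of_expanding hδ fun x hx y hy hxy => ?_
    have hsub : ∀ z ∈ Ioc (c j) (c (j + 1)), z ∈ Icc 0 L := fun z hz =>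
      ⟨hc0 ▸ (hmono 0 j (by lia) hj.le).trans hz.1.le,
        hcN ▸ hz.2.trans (hmono (j + 1) N hj le_rfl)⟩
    have h0 : (0 : ℝ) ∈ Icc 0 L := ⟨le_rfl, hL.le⟩
    rw [hD, hD, intervalIntegral.integral_interval_sub_left (hint 0 h0 y (hsub y hy))
      (hint 0 h0 x (hsub x hx))]
    exact mul_sub_le_abs_intervalIntegral_of_ae (hint x (hsub x hx) y (hsub y hy))
      hx.1.le hxy hy.2 (hsign j hj)
  refine ⟨N * (2 / δ) + L, by positivity, fun α hα => ?_⟩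
  rcases le_total α 1 with h1 | h1
  · have hcover : {s ∈ Ioo (0 : ℝ) L | |D s| < α} ⊆
        ⋃ j ∈ Finset.range N, {s ∈ Ioc (c j) (c (j + 1)) | |D s| < α} := by
      rintro s ⟨hs, hsα⟩
      have hmem : s ∈ Ioc (c 0) (c N) := by rw [hc0, hcN]; exact Ioo_subset_Ioc_self hs
      obtain ⟨j, hj, hsj⟩ := mem_iUnion₂.1 (Ioc_subset_biUnion_Ioc N c hmem)
      exact mem_iUnion₂.2 ⟨j, hj, hsj, hsα⟩
    calc volume {s ∈ Ioo (0 : ℝ) L | |D s| < α}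
        ≤ ∑ j ∈ Finset.range N, volume {s ∈ Ioc (c j) (c (j + 1)) | |D s| < α} :=
          (measure_mono hcover).trans (measure_biUnion_finset_le _ _)
      _ ≤ ∑ _j ∈ Finset.range N, ENNReal.ofReal (2 * α / δ) :=
          Finset.sum_le_sum fun j hj => hpiece α j (Finset.mem_range.1 hj)
      _ = ENNReal.ofReal (N * (2 * α / δ)) := by
          rw [Finset.sum_const, Finset.card_range, nsmul_eq_mul,
            ENNReal.ofReal_mul (Nat.cast_nonneg N), ENNReal.ofReal_natCast]
      _ ≤ ENNReal.ofReal ((N * (2 / δ) + L) * min α 1) := by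
          refine ENNReal.ofReal_le_ofReal ?_
          rw [min_eq_left h1, add_mul, mul_assoc, div_mul_eq_mul_div]
          exact le_add_of_nonneg_right (by positivity)
  · calc volume {s ∈ Ioo (0 : ℝ) L | |D s| < α} ≤ volume (Ioo 0 L) :=
          measure_mono (sep_subset _ _)
      _ = ENNReal.ofReal L := by rw [Real.volume_Ioo, sub_zero]
      _ ≤ ENNReal.ofReal ((N * (2 / δ) + L) * min α 1) := by
          refine ENNReal.ofReal_le_ofReal ?_
          rw [min_eq_right h1, mul_one]
          exact le_add_of_nonneg_left (by positivity)
end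

section
/- The integral ∫₀^L |D(s)|^{−1/2} ds is finite. -/
open MeasureTheory Set

theorem intervalIntegrable_abs_rpow {r : ℝ} (hr : -1 < r) (a b : ℝ) :
    IntervalIntegrable (fun x : ℝ => |x| ^ r) volume a b := by
  refine intervalIntegrable_of_even (fun x => by simp) (fun x hx => ?_)
  refine (intervalIntegral.intervalIntegrable_rpow' hr).congr ?_
  intro y hy
  rw [uIoc_of_le hx.le] at hy
  simp only [abs_of_pos hy.1]

/-- A negative power `r > -1` of the distance to a point has finite integral on compact
intervals. -/
theorem setLIntegral_ofReal_mul_abs_sub_rpow_lt_top {r δ : ℝ} (hr : -1 < r) (hδ : 0 < δ)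
    (a b p : ℝ) :
    ∫⁻ x in Icc a b, (ENNReal.ofReal (δ * |x - p|)) ^ r < ⊤ := by
  rcases lt_or_ge b a with hab | hab
  · simp [Icc_eq_empty (not_le.mpr hab)]
  have hint : IntegrableOn (fun x : ℝ => δ ^ r * |x - p| ^ r) (Icc a b) := by
    rw [← intervalIntegrable_iff_integrableOn_Icc_of_le hab]
    have h := (intervalIntegrable_abs_rpow hr (a - p) (b - p)).comp_sub_right p
    simp only [sub_add_cancel] at h
    exact h.const_mul _
  refine lt_of_le_of_lt (le_of_eq ?_) hint.lintegral_lt_top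
  refine lintegral_congr_ae ?_
  have hne : ∀ᵐ x ∂(volume.restrict (Icc a b)), x ≠ p := ae_restrict_of_ae (by
    simp [ae_iff])
  filter_upwards [hne] with x hx
  have hpos : 0 < |x - p| := abs_pos.mpr (sub_ne_zero.mpr hx)
  rw [ENNReal.ofReal_rpow_of_pos (mul_pos hδ hpos), Real.mul_rpow hδ.le hpos.le]

/-- A continuous function growing at rate at least `δ` dominates `δ` times the distance to some
point of the interval. -/
theorem exists_mul_abs_sub_le_abs {a b δ : ℝ} (hab : a ≤ b) {F : ℝ → ℝ}
    (hc : ContinuousOn F (Icc a b))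
    (hF : ∀ x ∈ Icc a b, ∀ y ∈ Icc a b, x ≤ y → δ * (y - x) ≤ F y - F x) :
    ∃ p, ∀ x ∈ Icc a b, δ * |x - p| ≤ |F x| := by
  have ha := left_mem_Icc.mpr hab
  have hb := right_mem_Icc.mpr hab
  rcases le_total 0 (F a) with h0 | h0
  · refine ⟨a, fun x hx => ?_⟩
    rw [abs_of_nonneg (sub_nonneg.mpr hx.1)]
    linarith [hF a ha x hx hx.1, le_abs_self (F x)]
  rcases le_total (F b) 0 with h1 | h1
  · refine ⟨b, fun x hx => ?_⟩
    rw [abs_sub_comm, abs_of_nonneg (sub_nonneg.mpr hx.2)]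
    linarith [hF x hx b hb hx.2, neg_le_abs (F x)]
  obtain ⟨p, hp, hp0⟩ := intermediate_value_Icc hab hc ⟨h0, h1⟩
  refine ⟨p, fun x hx => ?_⟩
  rcases le_total p x with h | h
  · rw [abs_of_nonneg (sub_nonneg.mpr h)]
    linarith [hF p hp x hx h, le_abs_self (F x)]
  · rw [abs_sub_comm, abs_of_nonneg (sub_nonneg.mpr h)]
    linarith [hF x hx p hp h, neg_le_abs (F x)]

theorem mul_sub_le_integral_of_ae_le {a b δ : ℝ} {f : ℝ → ℝ}
    (hf : IntegrableOn f (Icc a b))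
    (h : ∀ᵐ s ∂(volume.restrict (Ioo a b)), δ ≤ f s) {x y : ℝ}
    (hx : x ∈ Icc a b) (hy : y ∈ Icc a b) (hxy : x ≤ y) :
    δ * (y - x) ≤ ∫ t in x..y, f t := by
  have hi : IntervalIntegrable f volume x y :=
    (intervalIntegrable_iff_integrableOn_Icc_of_le hxy).mpr
      (hf.mono_set (Icc_subset_Icc hx.1 hy.2))
  have hle : (fun _ => δ) ≤ᵐ[volume.restrict (Icc x y)] f := by
    rw [restrict_Ioo_eq_restrict_Icc] at h
    exact ae_restrict_of_ae_restrict_of_subset (Icc_subset_Icc hx.1 hy.2) h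
  have := intervalIntegral.integral_mono_ae_restrict hxy intervalIntegrable_const hi hle
  simpa [mul_comm] using this

/-- A primitive of a function bounded below by `δ > 0` on `(a, b)` has `|F| ^ r` of finite
integral over `[a, b]` for `-1 < r ≤ 0`. -/
theorem setLIntegral_abs_primitive_rpow_lt_top {a b δ r : ℝ} (hab : a ≤ b) (hδ : 0 < δ)
    (hr : -1 < r) (hr0 : r ≤ 0) {f F : ℝ → ℝ} (hf : IntegrableOn f (Icc a b))
    (hF : ∀ x ∈ Icc a b, ∀ y ∈ Icc a b, F y - F x = ∫ t in x..y, f t)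
    (h : ∀ᵐ s ∂(volume.restrict (Ioo a b)), δ ≤ f s) :
    ∫⁻ s in Icc a b, (ENNReal.ofReal |F s|) ^ r < ⊤ := by
  have hcont : ContinuousOn F (Icc a b) := by
    have h1 : ContinuousOn (fun x => F a + ∫ t in a..x, f t) (Icc a b) := by
      have := intervalIntegral.continuousOn_primitive_interval (μ := volume)
        (f := f) (a := a) (b := b) (by rwa [uIcc_of_le hab])
      rw [uIcc_of_le hab] at this
      exact continuousOn_const.add this
    exact h1.congr fun x hx => by
      simp [← hF a (left_mem_Icc.mpr hab) x hx]
  obtain ⟨p, hp⟩ := exists_mul_abs_sub_le_abs hab hcont fun x hx y hy hxy => by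
    rw [hF x hx y hy]
    exact mul_sub_le_integral_of_ae_le hf h hx hy hxy
  refine lt_of_le_of_lt (setLIntegral_mono' measurableSet_Icc fun x hx => ?_)
    (setLIntegral_ofReal_mul_abs_sub_rpow_lt_top hr hδ a b p)
  rw [← neg_neg r, ENNReal.rpow_neg, ENNReal.rpow_neg _ (-r)]
  exact ENNReal.inv_le_inv.mpr
    (ENNReal.rpow_le_rpow (ENNReal.ofReal_le_ofReal (hp x hx)) (neg_nonneg.mpr hr0))

/-- If `d0` is bounded away from zero and changes sign finitely many times on
`[0, L]`, then `∫₀^L |D(s)|^{-1/2} ds < ∞`. -/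
theorem integral_inv_sqrt_D_finite
    (L : ℝ) (hL : 0 < L) (d0 : ℝ → ℝ)
    (hd0int : IntegrableOn d0 (Icc 0 L))
    (D : ℝ → ℝ) (hD : ∀ s, D s = ∫ t in (0:ℝ)..s, d0 t)
    (hpw : ∃ δ > (0:ℝ), ∃ N : ℕ, 0 < N ∧ ∃ c : ℕ → ℝ,
      c 0 = 0 ∧ c N = L ∧ (∀ j < N, c j < c (j + 1)) ∧
      (∀ j < N,
        (∀ᵐ s ∂(volume.restrict (Ioo (c j) (c (j + 1)))), δ ≤ d0 s) ∨
        (∀ᵐ s ∂(volume.restrict (Ioo (c j) (c (j + 1)))), d0 s ≤ -δ))) :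
    ∫⁻ s in Icc (0:ℝ) L, (ENNReal.ofReal |D s|) ^ (-(1/2 : ℝ)) < ⊤ := by
  obtain ⟨δ, hδ, N, -, c, hc0, hcN, hcmono, hsign⟩ := hpw
  have hmono : ∀ i j, i ≤ j → j ≤ N → c i ≤ c j := by
    intro i j hij
    induction j, hij using Nat.le_induction with
    | base => exact fun _ => le_rfl
    | succ j _ ih => exact fun hj => (ih (by omega)).trans (hcmono j (by omega)).le
  have hpiece : ∀ j < N,
      ∫⁻ s in Icc (c j) (c (j + 1)), (ENNReal.ofReal |D s|) ^ (-(1/2 : ℝ)) < ⊤ := by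
    intro j hj
    have hsub : Icc (c j) (c (j + 1)) ⊆ Icc 0 L :=
      Icc_subset_Icc (hc0 ▸ hmono 0 j (Nat.zero_le j) hj.le) (hcN ▸ hmono (j + 1) N hj le_rfl)
    have hint := hd0int.mono_set hsub
    have hI : ∀ x ∈ Icc (c j) (c (j + 1)), IntervalIntegrable d0 volume 0 x := fun x hx =>
      (intervalIntegrable_iff_integrableOn_Icc_of_le (hsub hx).1).mpr
        (hd0int.mono_set (Icc_subset_Icc_right (hsub hx).2))
    have hdiff : ∀ x ∈ Icc (c j) (c (j + 1)), ∀ y ∈ Icc (c j) (c (j + 1)),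
        D y - D x = ∫ t in x..y, d0 t := fun x hx y hy => by
      rw [hD, hD, intervalIntegral.integral_interval_sub_left (hI y hy) (hI x hx)]
    rcases hsign j hj with h | h
    · exact setLIntegral_abs_primitive_rpow_lt_top (hcmono j hj).le hδ (by norm_num)
        (by norm_num) hint hdiff h
    · have := setLIntegral_abs_primitive_rpow_lt_top (r := -(1/2 : ℝ)) (F := fun s => -D s)
        (f := fun s => -d0 s) (hcmono j hj).le hδ (by norm_num) (by norm_num) hint.neg
        (fun x hx y hy => by
          rw [intervalIntegral.integral_neg, ← hdiff x hx y hy]; ring)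
        (h.mono fun s hs => by linarith)
      simpa only [abs_neg] using this
  have hall : ∀ k ≤ N, ∫⁻ s in Icc (c 0) (c k), (ENNReal.ofReal |D s|) ^ (-(1/2 : ℝ)) < ⊤ := by
    intro k
    induction k with
    | zero => simp
    | succ k ih =>
      intro hk
      rw [← Icc_union_Icc_eq_Icc (hmono 0 k (Nat.zero_le k) (by omega)) (hcmono k hk).le]
      exact (lintegral_union_le _ _ _).trans_lt
        (ENNReal.add_lt_top.mpr ⟨ih (by omega), hpiece k hk⟩)
  simpa only [hc0, hcN] using hall N le_rfl
end

section
/- Let φ:ℝ→[0,1] be a smooth function with φ(x)=1 for |x|≤1 and φ(x)=0 for |x|≥2, and for R>0 set φ_R(x):=φ(x/R). There exists a constant C>0 (depending only on d0, L, and φ) such that for all a∈ℝ with a≠0, all R>0, and all ε>0, one has |∫_{{s∈[0,L] : |D(s)|>ε}} e^{−i a/(4 D(s))} · φ_R(D(s)) / |D(s)| ds| ≤ C · R / |a|. -/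
open MeasureTheory Set

/-- A function whose increments are controlled by those of an absolutely continuous function is
absolutely continuous. -/
theorem AbsolutelyContinuousOnInterval.of_dist_le {f g : ℝ → ℝ} {a b C : ℝ}
    (hf : AbsolutelyContinuousOnInterval f a b)
    (h : ∀ x ∈ uIcc a b, ∀ y ∈ uIcc a b, dist (g x) (g y) ≤ C * dist (f x) (f y)) :
    AbsolutelyContinuousOnInterval g a b := by
  refine squeeze_zero' (Filter.Eventually.of_forall fun t => Finset.sum_nonneg fun i _ => dist_nonneg)
    ?_ (by simpa using Filter.Tendsto.const_mul C hf)
  refine Filter.eventually_inf_principal.2 (Filter.Eventually.of_forall fun t ht => ?_)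
  rw [Finset.mul_sum]
  exact Finset.sum_le_sum fun i hi => h _ (ht.1 i hi).1 _ (ht.1 i hi).2

/-- If `K' = f` off `{-ε, ε}`, `|K| ≤ M`, and `D' = G` with `G` absolutely continuous and
`|G| ≥ δ`, then `∫ f ∘ D = ∫ G⁻¹ (K ∘ D)'` is bounded through integration by parts. -/
theorem abs_integral_comp_le {p q δ ε M : ℝ} {c : NNReal} {D G g' K f : ℝ → ℝ} (hpq : p < q)
    (hδ : 0 < δ)
    (hg' : IntervalIntegrable g' volume p q)
    (hG : ∀ x, G x = G p + ∫ t in p..x, g' t)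
    (hD : ∀ s ∈ Icc p q, D s = D p + ∫ t in p..s, G t)
    (hGδ : ∀ x ∈ Icc p q, δ ≤ |G x|)
    (hK : LipschitzWith c K) (hKf : ∀ y, |y| ≠ ε → HasDerivAt K (f y) y)
    (hKM : ∀ y, |K y| ≤ M) :
    |∫ s in p..q, f (D s)| ≤ (2 / δ + (∫ t in p..q, |g' t|) / δ ^ 2) * M := by
  have huI : uIcc p q = Icc p q := uIcc_of_le hpq.le
  have hGne : ∀ x ∈ Icc p q, G x ≠ 0 := fun x hx => abs_pos.1 (hδ.trans_le (hGδ x hx))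
  have hGac : AbsolutelyContinuousOnInterval G p q := by
    refine (hg'.absolutelyContinuousOnInterval_intervalIntegral (c := p) (by simp)).of_dist_le
      (C := 1) fun x _ y _ => ?_
    rw [hG x, hG y, dist_add_left, one_mul]
  have hGc : ContinuousOn G (Icc p q) := huI ▸ hGac.continuousOn
  have hGi : IntervalIntegrable G volume p q :=
    (huI.symm ▸ hGc : ContinuousOn G (uIcc p q)).intervalIntegrable
  have hDac : AbsolutelyContinuousOnInterval D p q := by
    refine (hGi.absolutelyContinuousOnInterval_intervalIntegral (c := p) (by simp)).of_dist_le
      (C := 1) fun x hx y hy => ?_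
    rw [hD x (huI ▸ hx), hD y (huI ▸ hy), dist_add_left, one_mul]
  have hDc : ContinuousOn D (Icc p q) := huI ▸ hDac.continuousOn
  have hDd : ∀ x ∈ Ioo p q, HasDerivAt D (G x) x := by
    intro x hx
    have hGx : ContinuousOn G (Ioo p q) := hGc.mono Ioo_subset_Icc_self
    have h1 : HasDerivAt (fun s => D p + ∫ t in p..s, G t) (G x) x := by
      refine (intervalIntegral.integral_hasDerivAt_right ?_ ?_ ?_).const_add _
      · exact hGi.mono_set (by rw [huI, uIcc_of_le hx.1.le]; exact Icc_subset_Icc_right hx.2.le)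
      · exact hGx.stronglyMeasurableAtFilter isOpen_Ioo x hx
      · exact hGx.continuousAt (isOpen_Ioo.mem_nhds hx)
    refine h1.congr_of_eventuallyEq ?_
    filter_upwards [isOpen_Ioo.mem_nhds hx] with s hs using hD s (Ioo_subset_Icc_self hs)
  have hDinj : InjOn D (Icc p q) := by
    have key : ∀ x ∈ Icc p q, ∀ y ∈ Icc p q, x < y → D x ≠ D y := by
      intro x hx y hy hxy h
      obtain ⟨z, hz, h0⟩ := exists_hasDerivAt_eq_zero hxy (hDc.mono (Icc_subset_Icc hx.1 hy.2)) h
        (fun z hz => hDd z ⟨hx.1.trans_lt hz.1, hz.2.trans_le hy.2⟩)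
      exact hGne z ⟨hx.1.trans hz.1.le, hz.2.le.trans hy.2⟩ h0
    intro x hx y hy h
    rcases lt_trichotomy x y with h' | h' | h'
    · exact absurd h (key x hx y hy h')
    · exact h'
    · exact absurd h.symm (key y hy x hx h')
  have hnull : ∀ r : ℝ, ∀ᵐ x, x ∈ Icc p q → D x ≠ r := by
    intro r
    have : (Icc p q ∩ D ⁻¹' {r}).Subsingleton := fun x hx y hy =>
      hDinj hx.1 hy.1 (hx.2.trans hy.2.symm)
    filter_upwards [measure_eq_zero_iff_ae_notMem.1 (this.measure_zero volume)] with x hx h1 h2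
    exact hx ⟨h1, h2⟩
  have huac : AbsolutelyContinuousOnInterval (fun x => K (D x)) p q :=
    hDac.of_dist_le fun x _ y _ => hK.dist_le_mul _ _
  have hiac : AbsolutelyContinuousOnInterval (fun x => (G x)⁻¹) p q := by
    refine hGac.of_dist_le (C := (δ ^ 2)⁻¹) fun x hx y hy => ?_
    rw [huI] at hx hy
    rw [dist_inv_inv₀ (hGne x hx) (hGne y hy), div_eq_inv_mul]
    refine mul_le_mul_of_nonneg_right (inv_anti₀ (by positivity) ?_) dist_nonneg
    rw [sq]
    exact mul_le_mul (hGδ x hx) (hGδ y hy) hδ.le (abs_nonneg _)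
  have hne : ∀ᵐ x, x ≠ q := by simp [ae_iff]
  have h1 : ∫ s in p..q, f (D s) = ∫ s in p..q, (G s)⁻¹ * deriv (fun x => K (D x)) s := by
    refine intervalIntegral.integral_congr_ae ?_
    filter_upwards [hne, hnull ε, hnull (-ε)] with x hx h1 h2 hxm
    rw [uIoc_of_le hpq.le] at hxm
    have hxo : x ∈ Ioo p q := ⟨hxm.1, lt_of_le_of_ne hxm.2 hx⟩
    have hxc := Ioo_subset_Icc_self hxo
    have hab : |D x| ≠ ε := by
      intro h
      rcases abs_choice (D x) with h' | h'
      · exact h1 hxc (h' ▸ h)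
      · exact h2 hxc (by rw [← h, h', neg_neg])
    have hd : deriv (fun x => K (D x)) x = f (D x) * G x :=
      ((hKf _ hab).comp x (hDd x hxo)).deriv
    rw [hd, mul_comm, mul_inv_cancel_right₀ (hGne x hxc)]
  have hdi : ∀ᵐ x, x ∈ Ioc p q → |deriv (fun x => (G x)⁻¹) x * K (D x)| ≤ |g' x| * (M / δ ^ 2) := by
    filter_upwards [hg'.ae_hasDerivAt_integral] with x hx hxm
    have hxc := Ioc_subset_Icc_self hxm
    have hGd : HasDerivAt G (g' x) x := by
      rw [show G = fun x => G p + ∫ t in p..x, g' t from funext hG]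
      exact (hx (huI ▸ hxc) p (by simp)).const_add _
    rw [(hGd.fun_inv (hGne x hxc)).deriv, abs_mul, abs_div, abs_neg, div_mul_eq_mul_div,
      mul_div_assoc]
    refine mul_le_mul_of_nonneg_left ?_ (abs_nonneg _)
    refine div_le_div₀ ((abs_nonneg _).trans (hKM (D x))) (hKM _) (by positivity) ?_
    rw [abs_pow]
    exact pow_le_pow_left₀ hδ.le (hGδ x hxc) 2
  have h2 : |∫ x in p..q, deriv (fun x => (G x)⁻¹) x * K (D x)| ≤
      ∫ x in p..q, |g' x| * (M / δ ^ 2) := by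
    rw [← Real.norm_eq_abs]
    refine intervalIntegral.norm_integral_le_of_norm_le hpq.le ?_ (hg'.abs.mul_const _)
    filter_upwards [hdi] with x hx using hx
  have hb : ∀ x ∈ Icc p q, |(G x)⁻¹ * K (D x)| ≤ M / δ := by
    intro x hx
    rw [abs_mul, abs_inv, ← div_eq_inv_mul]
    exact div_le_div₀ ((abs_nonneg _).trans (hKM (D x))) (hKM _) hδ (hGδ x hx)
  have hp := hb p (left_mem_Icc.2 hpq.le)
  have hq := hb q (right_mem_Icc.2 hpq.le)
  rw [h1, hiac.integral_mul_deriv_eq_deriv_mul huac]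
  rw [intervalIntegral.integral_mul_const] at h2
  calc _ ≤ M / δ + M / δ + (∫ x in p..q, |g' x|) * (M / δ ^ 2) :=
        (abs_sub _ _).trans (add_le_add ((abs_sub _ _).trans (add_le_add hq hp)) h2)
    _ = _ := by ring


/-- Non-stationary phase bound for `e^{-ia/(4t)} φ(t/R)/t` on intervals avoiding `0`. -/
theorem exists_norm_oscillatory_integral_le {φ : ℝ → ℝ} (hφ : ContDiff ℝ (⊤ : ℕ∞) φ)
    (hφrange : ∀ x, φ x ∈ Icc (0 : ℝ) 1) (hφzero : ∀ x : ℝ, 2 ≤ |x| → φ x = 0) :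
    ∃ B > (0 : ℝ), ∀ a : ℝ, a ≠ 0 → ∀ R > (0 : ℝ), ∀ p q : ℝ, (0 : ℝ) ∉ uIcc p q →
      ‖∫ t in p..q, Complex.exp (-(Complex.I * a / (4 * t))) * ((φ (t / R) / t : ℝ) : ℂ)‖
        ≤ B * (R / |a|) := by
  set ψ : ℝ → ℝ := fun x => x * φ x with hψdef
  have hψ : ContDiff ℝ 1 ψ := contDiff_id.mul (hφ.of_le (by simp))
  have hψ' : Continuous (deriv ψ) := hψ.continuous_deriv le_rfl
  have hψc : HasCompactSupport ψ := by
    refine HasCompactSupport.of_support_subset_isCompact (isCompact_Icc (a := -2) (b := 2)) ?_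
    intro x hx
    rw [mem_Icc, ← abs_le]
    by_contra h
    exact hx (by simp [hψdef, hφzero x (not_le.1 h).le])
  have hψi : Integrable (fun x => |deriv ψ x|) :=
    (hψ'.integrable_of_hasCompactSupport hψc.deriv).abs
  have hψ2 : ∀ x, |ψ x| ≤ 2 := by
    intro x
    rcases le_total 2 |x| with h | h
    · simp [hψdef, hφzero x h]
    · rw [abs_mul, abs_of_nonneg (hφrange x).1]
      nlinarith [(hφrange x).1, (hφrange x).2, abs_nonneg x]
  set V := ∫ x, |deriv ψ x| with hV
  have hV0 : 0 ≤ V := integral_nonneg fun _ => abs_nonneg _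
  refine ⟨16 + 4 * V, by positivity, fun a ha R hR p q h0 => ?_⟩
  have hne : ∀ t ∈ uIcc p q, t ≠ 0 := fun t ht h => h0 (h ▸ ht)
  have haC : (a : ℂ) ≠ 0 := by exact_mod_cast ha
  have hRC : (R : ℂ) ≠ 0 := by exact_mod_cast hR.ne'
  set E : ℝ → ℂ := fun t => Complex.exp (-(Complex.I * a / (4 * t))) with hE
  have hEn : ∀ t, ‖E t‖ = 1 := by
    intro t
    have : E t = Complex.exp ((-(a / (4 * t)) : ℝ) * Complex.I) := by
      simp only [hE]; congr 1; push_cast; ring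
    rw [this, Complex.norm_exp_ofReal_mul_I]
  have hEd : ∀ t ∈ uIcc p q, HasDerivAt E (E t * (Complex.I * a / (4 * t ^ 2))) t := by
    intro t ht
    have htC : (t : ℂ) ≠ 0 := by exact_mod_cast hne t ht
    have h := ((((hasDerivAt_id (t : ℂ)).const_mul 4).fun_inv (by simpa using htC)).const_mul
      (Complex.I * a)).neg.cexp.comp_ofReal
    refine (h.congr_deriv ?_).congr_of_eventuallyEq (.of_forall fun s => ?_)
    · simp only [hE, id, div_eq_mul_inv, Pi.neg_apply]
      field_simp
    · simp only [hE, id, div_eq_mul_inv, Pi.neg_apply]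
  set P : ℝ → ℂ := fun t => ((R * ψ (t / R) : ℝ) : ℂ) with hP
  have hPd : ∀ t, HasDerivAt P ((deriv ψ (t / R) : ℝ) : ℂ) t := by
    intro t
    have h1 : HasDerivAt ψ (deriv ψ (t / R)) (t / R) :=
      (hψ.differentiable one_ne_zero _).hasDerivAt
    have h2 := (h1.comp t ((hasDerivAt_id t).div_const R)).const_mul R
    refine HasDerivAt.ofReal_comp (h2.congr_deriv ?_)
    field_simp
  have hPn : ∀ t, ‖P t‖ ≤ 2 * R := by
    intro t
    rw [hP, Complex.norm_real, Real.norm_eq_abs, abs_mul, abs_of_pos hR]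
    nlinarith [hψ2 (t / R)]
  have hEc : ContinuousOn E (uIcc p q) := fun t ht => (hEd t ht).continuousAt.continuousWithinAt
  have hE'c : ContinuousOn (fun t : ℝ => E t * (Complex.I * a / (4 * t ^ 2))) (uIcc p q) := by
    refine hEc.mul (continuousOn_const.div (by fun_prop) fun t ht => ?_)
    have htC : (t : ℂ) ≠ 0 := by exact_mod_cast hne t ht
    simpa using htC
  have hP'c : Continuous fun t : ℝ => ((deriv ψ (t / R) : ℝ) : ℂ) := by fun_prop
  have ibp := intervalIntegral.integral_mul_deriv_eq_deriv_mul (fun t _ => hPd t) hEd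
    (hP'c.intervalIntegrable _ _) hE'c.intervalIntegrable
  have heq : ∫ t in p..q, E t * ((φ (t / R) / t : ℝ) : ℂ) =
      (4 / (Complex.I * a)) * ∫ t in p..q, P t * (E t * (Complex.I * a / (4 * t ^ 2))) := by
    rw [← intervalIntegral.integral_const_mul]
    refine intervalIntegral.integral_congr fun t ht => ?_
    have htC : (t : ℂ) ≠ 0 := by exact_mod_cast hne t ht
    have hI := Complex.I_ne_zero
    simp only [hP, hψdef]
    push_cast
    field_simp
  have hint : ‖∫ t in p..q, ((deriv ψ (t / R) : ℝ) : ℂ) * E t‖ ≤ R * V := by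
    refine (intervalIntegral.norm_integral_le_abs_integral_norm).trans ?_
    have : ∀ t, ‖((deriv ψ (t / R) : ℝ) : ℂ) * E t‖ = |deriv ψ (t / R)| := by
      intro t; rw [norm_mul, hEn, mul_one, Complex.norm_real, Real.norm_eq_abs]
    simp_rw [this]
    rw [intervalIntegral.integral_comp_div (fun x => |deriv ψ x|) hR.ne', smul_eq_mul, abs_mul,
      abs_of_pos hR]
    refine mul_le_mul_of_nonneg_left ?_ hR.le
    rw [intervalIntegral.abs_integral_eq_abs_integral_uIoc,
      abs_of_nonneg (integral_nonneg fun _ => abs_nonneg _)]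
    exact setIntegral_le_integral hψi (.of_forall fun _ => abs_nonneg _)
  have hbd : ∀ t, ‖P t * E t‖ ≤ 2 * R := fun t => by rw [norm_mul, hEn, mul_one]; exact hPn t
  rw [heq, ibp, norm_mul]
  have hc : ‖4 / (Complex.I * a)‖ = 4 / |a| := by simp
  rw [hc]
  calc _ ≤ 4 / |a| * (2 * R + 2 * R + R * V) := by
        refine mul_le_mul_of_nonneg_left ?_ (by positivity)
        exact (norm_sub_le _ _).trans (add_le_add ((norm_sub_le _ _).trans
          (add_le_add (hbd q) (hbd p))) hint)
    _ = _ := by ring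

/-- The kernel of the oscillatory integral, truncated to `ε < |y|`. -/
noncomputable def truncatedKernel (φ : ℝ → ℝ) (a R ε y : ℝ) : ℂ :=
  if ε < |y| then Complex.exp (-(Complex.I * a / (4 * y))) * ((φ (y / R) / |y| : ℝ) : ℂ) else 0

theorem measurable_truncatedKernel {φ : ℝ → ℝ} (hφ : Continuous φ) (a R ε : ℝ) :
    Measurable (truncatedKernel φ a R ε) := by
  have := hφ.measurable
  refine Measurable.ite (measurableSet_lt measurable_const (by fun_prop)) ?_ measurable_const
  exact (by fun_prop : Measurable fun y : ℝ => Complex.exp (-(Complex.I * a / (4 * y)))).mul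
    (Complex.measurable_ofReal.comp ((this.comp (by fun_prop)).div (by fun_prop)))

theorem norm_truncatedKernel_le {φ : ℝ → ℝ} (hφrange : ∀ x, φ x ∈ Icc (0 : ℝ) 1) (a R : ℝ)
    {ε : ℝ} (hε : 0 < ε) (y : ℝ) : ‖truncatedKernel φ a R ε y‖ ≤ 1 / ε := by
  unfold truncatedKernel
  split_ifs with h
  · have : -(Complex.I * a / (4 * y)) = ((-(a / (4 * y)) : ℝ) : ℂ) * Complex.I := by
      push_cast; ring
    rw [norm_mul, this, Complex.norm_exp_ofReal_mul_I, one_mul, Complex.norm_real,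
      Real.norm_eq_abs, abs_div, abs_abs, abs_of_nonneg (hφrange _).1]
    exact div_le_div₀ zero_le_one (hφrange _).2 hε h.le
  · simpa using hε.le

theorem continuousAt_truncatedKernel {φ : ℝ → ℝ} (hφ : Continuous φ) (a R : ℝ) {ε y : ℝ}
    (hε : 0 < ε) (hy : |y| ≠ ε) : ContinuousAt (truncatedKernel φ a R ε) y := by
  rcases lt_or_gt_of_ne hy with h | h
  · refine (continuousAt_const (y := (0 : ℂ))).congr ?_
    filter_upwards [(isOpen_lt continuous_abs continuous_const).mem_nhds h] with z hz
    exact (if_neg (not_lt.2 (le_of_lt hz))).symm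
  · have hy0 : y ≠ 0 := abs_pos.1 (hε.trans h)
    have hyC : (y : ℂ) ≠ 0 := by exact_mod_cast hy0
    have hc : ContinuousAt (fun y : ℝ => Complex.exp (-(Complex.I * a / (4 * y))) *
        ((φ (y / R) / |y| : ℝ) : ℂ)) y := by
      refine ContinuousAt.mul ?_ ?_
      · refine (ContinuousAt.div (by fun_prop) (by fun_prop) (by simpa using hyC)).neg.cexp
      · exact Complex.continuous_ofReal.continuousAt.comp
          (ContinuousAt.div (by fun_prop) (by fun_prop) (by simpa using hy0))
    refine hc.congr ?_
    filter_upwards [(isOpen_lt continuous_const continuous_abs).mem_nhds h] with z hz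
    exact (if_pos hz).symm

theorem intervalIntegrable_truncatedKernel {φ : ℝ → ℝ} (hφ : Continuous φ)
    (hφrange : ∀ x, φ x ∈ Icc (0 : ℝ) 1) (a R : ℝ) {ε : ℝ} (hε : 0 < ε) (p q : ℝ) :
    IntervalIntegrable (truncatedKernel φ a R ε) volume p q :=
  (intervalIntegrable_const (c := 1 / ε)).mono_fun
    (measurable_truncatedKernel hφ a R ε).aestronglyMeasurable
    (.of_forall fun y => (norm_truncatedKernel_le hφrange a R hε y).trans (le_abs_self _))

theorem exists_norm_primitive_truncatedKernel_le {φ : ℝ → ℝ} (hφ : ContDiff ℝ (⊤ : ℕ∞) φ)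
    (hφrange : ∀ x, φ x ∈ Icc (0 : ℝ) 1) (hφzero : ∀ x : ℝ, 2 ≤ |x| → φ x = 0) :
    ∃ B > (0 : ℝ), ∀ a : ℝ, a ≠ 0 → ∀ R > (0 : ℝ), ∀ ε > (0 : ℝ), ∀ y : ℝ,
      ‖∫ t in (0 : ℝ)..y, truncatedKernel φ a R ε t‖ ≤ B * (R / |a|) := by
  obtain ⟨B, hB, h⟩ := exists_norm_oscillatory_integral_le hφ hφrange hφzero
  refine ⟨B, hB, fun a ha R hR ε hε y => ?_⟩
  have hint := intervalIntegrable_truncatedKernel hφ.continuous hφrange a R hε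
  have hzero : ∀ z : ℝ, |z| ≤ ε → ∫ t in (0 : ℝ)..z, truncatedKernel φ a R ε t = 0 := by
    intro z hz
    refine intervalIntegral.integral_zero_ae (.of_forall fun t ht => if_neg (not_lt.2 ?_))
    have := abs_sub_left_of_mem_uIcc (uIoc_subset_uIcc ht)
    simp only [sub_zero] at this
    exact this.trans hz
  rcases le_or_gt |y| ε with hy | hy
  · rw [hzero y hy, norm_zero]; positivity
  rcases lt_abs.1 hy with hy | hy
  · rw [← intervalIntegral.integral_add_adjacent_intervals (hint 0 ε) (hint ε y),
      hzero ε (abs_of_pos hε).le, zero_add]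
    refine le_of_eq_of_le (congrArg _ ?_) (h a ha R hR ε y ?_)
    · refine intervalIntegral.integral_congr_ae (.of_forall fun t ht => ?_)
      rw [uIoc_of_le hy.le] at ht
      have : |t| = t := abs_of_pos (hε.trans ht.1)
      rw [truncatedKernel, this, if_pos ht.1]
    · rw [uIcc_of_le hy.le]; exact fun h => absurd h.1 (not_le.2 hε)
  · have hy' : y < -ε := by linarith
    rw [← intervalIntegral.integral_add_adjacent_intervals (hint 0 (-ε)) (hint (-ε) y),
      hzero (-ε) (by rw [abs_neg, abs_of_pos hε]), zero_add]
    refine le_of_eq_of_le ?_ (h a ha R hR (-ε) y ?_)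
    · rw [← norm_neg, ← intervalIntegral.integral_neg]
      refine congrArg _ (intervalIntegral.integral_congr_ae ?_)
      have hne : ∀ᵐ t : ℝ, t ≠ -ε := by simp [ae_iff]
      filter_upwards [hne] with t hte ht
      rw [uIoc_of_ge hy'.le] at ht
      have h1 : t < -ε := lt_of_le_of_ne ht.2 hte
      have : |t| = -t := abs_of_neg (by linarith)
      rw [truncatedKernel, this, if_pos (by linarith), div_neg]
      push_cast
      ring
    · rw [uIcc_of_ge hy'.le]; exact fun h => absurd h.2 (by linarith)

theorem exists_lipschitzWith_primitive_truncatedKernel {φ : ℝ → ℝ} (hφ : Continuous φ)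
    (hφrange : ∀ x, φ x ∈ Icc (0 : ℝ) 1) (a R : ℝ) {ε : ℝ} (hε : 0 < ε) :
    ∃ c, LipschitzWith c fun y => ∫ t in (0 : ℝ)..y, truncatedKernel φ a R ε t := by
  have hint := intervalIntegrable_truncatedKernel hφ hφrange a R hε
  refine ⟨⟨1 / ε, by positivity⟩, LipschitzWith.of_dist_le_mul fun x y => ?_⟩
  rw [dist_eq_norm, intervalIntegral.integral_interval_sub_left (hint 0 x) (hint 0 y),
    Real.dist_eq]
  exact intervalIntegral.norm_integral_le_of_norm_le_const fun t _ =>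
    norm_truncatedKernel_le hφrange a R hε t

theorem hasDerivAt_primitive_truncatedKernel {φ : ℝ → ℝ} (hφ : Continuous φ)
    (hφrange : ∀ x, φ x ∈ Icc (0 : ℝ) 1) (a R : ℝ) {ε y : ℝ} (hε : 0 < ε) (hy : |y| ≠ ε) :
    HasDerivAt (fun y => ∫ t in (0 : ℝ)..y, truncatedKernel φ a R ε t)
      (truncatedKernel φ a R ε y) y :=
  intervalIntegral.integral_hasDerivAt_right
    (intervalIntegrable_truncatedKernel hφ hφrange a R hε 0 y)
    (measurable_truncatedKernel hφ a R ε).stronglyMeasurable.stronglyMeasurableAtFilter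
    (continuousAt_truncatedKernel hφ a R hε hy)

theorem norm_integral_comp_le {p q δ ε M : ℝ} {c : NNReal} {D G g' : ℝ → ℝ} {K f : ℝ → ℂ}
    (hpq : p < q) (hδ : 0 < δ)
    (hg' : IntervalIntegrable g' volume p q)
    (hG : ∀ x, G x = G p + ∫ t in p..x, g' t)
    (hD : ∀ s ∈ Icc p q, D s = D p + ∫ t in p..s, G t)
    (hGδ : ∀ x ∈ Icc p q, δ ≤ |G x|)
    (hK : LipschitzWith c K) (hKf : ∀ y, |y| ≠ ε → HasDerivAt K (f y) y)
    (hKM : ∀ y, ‖K y‖ ≤ M) (hfD : IntervalIntegrable (fun s => f (D s)) volume p q) :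
    ‖∫ s in p..q, f (D s)‖ ≤ 2 * (2 / δ + (∫ t in p..q, |g' t|) / δ ^ 2) * M := by
  have key : ∀ l : ℂ →L[ℝ] ℝ, (∀ z, |l z| ≤ ‖z‖) →
      |l (∫ s in p..q, f (D s))| ≤ (2 / δ + (∫ t in p..q, |g' t|) / δ ^ 2) * M := by
    intro l hl
    rw [← l.intervalIntegral_comp_comm hfD]
    refine abs_integral_comp_le (K := fun y => l (K y)) (f := fun y => l (f y)) hpq hδ hg' hG hD hGδ
      (LipschitzWith.of_dist_le_mul (K := c) fun x y => ?_)
      (fun y hy => l.hasFDerivAt.comp_hasDerivAt y (hKf y hy)) fun y => (hl _).trans (hKM y)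
    rw [Real.dist_eq, ← map_sub]
    exact (hl _).trans ((dist_eq_norm _ _).symm.trans_le (hK.dist_le_mul x y))
  have h1 := key Complex.reCLM Complex.abs_re_le_norm
  have h2 := key Complex.imCLM Complex.abs_im_le_norm
  refine (Complex.norm_le_abs_re_add_abs_im _).trans ((add_le_add h1 h2).trans_eq ?_)
  ring

theorem exists_norm_integral_comp_le {p q δ : ℝ} {d0 D g g' : ℝ → ℝ} (hpq : p < q) (hδ : 0 < δ)
    (hg' : IntegrableOn g' (Ioo p q))
    (hg : ∀ x ∈ Ioo p q, ∀ y ∈ Ioo p q, g y - g x = ∫ t in x..y, g' t)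
    (hd0 : ∀ᵐ s ∂(volume.restrict (Ioo p q)), d0 s = g s)
    (hd0δ : ∀ᵐ s ∂(volume.restrict (Ioo p q)), δ ≤ |d0 s|)
    (hD : ∀ s ∈ Icc p q, D s = D p + ∫ t in p..s, d0 t) :
    ∃ A ≥ (0 : ℝ), ∀ (c : NNReal) (K f : ℝ → ℂ) (ε M : ℝ), LipschitzWith c K →
      (∀ y, |y| ≠ ε → HasDerivAt K (f y) y) → (∀ y, ‖K y‖ ≤ M) →
      IntervalIntegrable (fun s => f (D s)) volume p q →
      ‖∫ s in p..q, f (D s)‖ ≤ A * M := by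
  set k : ℝ → ℝ := (Ioo p q).indicator g' with hk
  have hki : Integrable k := (integrable_indicator_iff measurableSet_Ioo).2 hg'
  set m := (p + q) / 2 with hm
  have hmI : m ∈ Ioo p q := ⟨by linarith, by linarith⟩
  set G : ℝ → ℝ := fun x => g m + ∫ t in m..x, k t with hGdef
  have hGp : ∀ x, G x = G p + ∫ t in p..x, k t := by
    intro x
    simp only [hGdef]
    rw [add_assoc, intervalIntegral.integral_add_adjacent_intervals hki.intervalIntegrable
      hki.intervalIntegrable]
  have hGc : Continuous G :=
    continuous_const.add (intervalIntegral.continuous_primitive (fun _ _ => hki.intervalIntegrable) m)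
  have hGg : ∀ x ∈ Ioo p q, G x = g x := by
    intro x hx
    have : ∫ t in m..x, k t = ∫ t in m..x, g' t :=
      intervalIntegral.integral_congr fun t ht =>
        indicator_of_mem (ordConnected_Ioo.uIcc_subset hmI hx ht) _
    simp only [hGdef]
    rw [this, ← hg m hmI x hx]
    ring
  have hdG : ∀ᵐ s ∂(volume.restrict (Ioo p q)), d0 s = G s := by
    filter_upwards [hd0, ae_restrict_mem measurableSet_Ioo] with s hs hsI
    rw [hs, hGg s hsI]
  have hGδ : ∀ x ∈ Icc p q, δ ≤ |G x| := by
    have hae : (fun x => min δ |G x|) =ᵐ[volume.restrict (Icc p q)] fun _ => δ := by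
      rw [← Measure.restrict_congr_set Ioo_ae_eq_Icc]
      filter_upwards [hdG, hd0δ] with s h1 h2
      rw [← h1, min_eq_left h2]
    have := Measure.eqOn_Icc_of_ae_eq volume hpq.ne hae (by fun_prop) continuousOn_const
    exact fun x hx => min_eq_left_iff.1 (this hx)
  have hDG : ∀ s ∈ Icc p q, D s = D p + ∫ t in p..s, G t := by
    intro s hs
    rw [hD s hs]
    congr 1
    refine intervalIntegral.integral_congr_ae ?_
    have hne : ∀ᵐ t : ℝ, t ≠ q := by simp [ae_iff]
    filter_upwards [(ae_restrict_iff' measurableSet_Ioo).1 hdG, hne] with t ht htq hts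
    rw [uIoc_of_le hs.1] at hts
    exact ht ⟨hts.1, lt_of_le_of_ne (hts.2.trans hs.2) htq⟩
  refine ⟨2 * (2 / δ + (∫ t in p..q, |k t|) / δ ^ 2), ?_, fun c K f ε M hK hKf hKM hfD =>
    norm_integral_comp_le hpq hδ hki.intervalIntegrable hGp hDG hGδ hK hKf hKM hfD⟩
  have : 0 ≤ ∫ t in p..q, |k t| :=
    intervalIntegral.integral_nonneg hpq.le fun _ _ => abs_nonneg _
  positivity

/-- If `d0` is piecewise `W^{1,1}` and bounded away from zero on `[0, L]`, then
the regularized oscillatory integral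
`∫_{|D| > ε} e^{-ia/(4D(s))} φ_R(D(s))/|D(s)| ds` is bounded by `C·R/|a|`. -/
theorem oscillatory_integral_singular_kernel_bound
    (L : ℝ) (hL : 0 < L) (d0 : ℝ → ℝ)
    (hd0int : IntegrableOn d0 (Icc 0 L))
    (D : ℝ → ℝ) (hD : ∀ s, D s = ∫ t in (0:ℝ)..s, d0 t)
    (hbdd : ∃ δ > (0:ℝ), ∀ᵐ s ∂(volume.restrict (Icc (0:ℝ) L)), δ ≤ |d0 s|)
    (hpw : ∃ N : ℕ, 0 < N ∧ ∃ c : ℕ → ℝ,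
      c 0 = 0 ∧ c N = L ∧ (∀ j < N, c j < c (j + 1)) ∧
      (∀ j < N, ∃ g g' : ℝ → ℝ,
        IntegrableOn g' (Ioo (c j) (c (j + 1))) ∧
        (∀ x ∈ Ioo (c j) (c (j + 1)), ∀ y ∈ Ioo (c j) (c (j + 1)),
          g y - g x = ∫ t in x..y, g' t) ∧
        (∀ᵐ s ∂(volume.restrict (Ioo (c j) (c (j + 1)))), d0 s = g s)))
    (φ : ℝ → ℝ) (hφsmooth : ContDiff ℝ (⊤ : ℕ∞) φ) (hφrange : ∀ x, φ x ∈ Icc (0:ℝ) 1)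
    (hφone : ∀ x : ℝ, |x| ≤ 1 → φ x = 1) (hφzero : ∀ x : ℝ, 2 ≤ |x| → φ x = 0) :
    ∃ C > (0:ℝ), ∀ a : ℝ, a ≠ 0 → ∀ R > (0:ℝ), ∀ ε > (0:ℝ),
      ‖∫ s in {s ∈ Icc (0:ℝ) L | ε < |D s|},
          Complex.exp (-(Complex.I * a / (4 * D s))) * ((φ (D s / R) / |D s| : ℝ) : ℂ)‖
        ≤ C * R / |a| := by
  obtain ⟨δ, hδ, hd0δ⟩ := hbdd
  obtain ⟨N, -, c, hc0, hcN, hlt, hpiece⟩ := hpw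
  have hmono : ∀ k i, i + k ≤ N → c i ≤ c (i + k) := by
    intro k
    induction k with
    | zero => exact fun i _ => le_rfl
    | succ k ih => exact fun i hi => (ih i (by omega)).trans (hlt (i + k) (by omega)).le
  have hcI : ∀ j ≤ N, c j ∈ Icc 0 L := by
    intro j hj
    constructor
    · have := hmono j 0 (by omega)
      rwa [zero_add, hc0] at this
    · have := hmono (N - j) j (by omega)
      rwa [Nat.add_sub_cancel' hj, hcN] at this
  have hii : ∀ x ∈ Icc 0 L, ∀ y ∈ Icc 0 L, IntervalIntegrable d0 volume x y := fun x hx y hy =>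
    (hd0int.mono_set (ordConnected_Icc.uIcc_subset hx hy)).intervalIntegrable
  have h0I : (0 : ℝ) ∈ Icc 0 L := left_mem_Icc.2 hL.le
  have hDc : ContinuousOn D (Icc 0 L) := by
    rw [show D = fun s => ∫ t in (0:ℝ)..s, d0 t from funext hD, ← uIcc_of_le hL.le]
    exact intervalIntegral.continuousOn_primitive_interval (by rwa [uIcc_of_le hL.le])
  have hA : ∀ j, ∃ A ≥ (0 : ℝ), j < N → ∀ (b : NNReal) (K f : ℝ → ℂ) (ε M : ℝ),
      LipschitzWith b K → (∀ y, |y| ≠ ε → HasDerivAt K (f y) y) → (∀ y, ‖K y‖ ≤ M) →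
      IntervalIntegrable (fun s => f (D s)) volume (c j) (c (j + 1)) →
      ‖∫ s in c j..c (j + 1), f (D s)‖ ≤ A * M := by
    intro j
    by_cases hj : j < N
    swap
    · exact ⟨0, le_rfl, fun h => absurd h hj⟩
    obtain ⟨g, g', hg', hg, hd0⟩ := hpiece j hj
    have hp := hcI j hj.le
    have hq := hcI (j + 1) hj
    have hsub : Icc (c j) (c (j + 1)) ⊆ Icc 0 L := Icc_subset_Icc hp.1 hq.2
    obtain ⟨A, hA0, hA⟩ := exists_norm_integral_comp_le (D := D) (hlt j hj) hδ hg' hg hd0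
      (ae_restrict_of_ae_restrict_of_subset (Ioo_subset_Icc_self.trans hsub) hd0δ)
      (fun s hs => by
        rw [hD s, hD (c j), intervalIntegral.integral_add_adjacent_intervals
          (hii _ h0I _ hp) (hii _ hp _ (hsub hs))])
    exact ⟨A, hA0, fun _ => hA⟩
  choose A hA0 hA using hA
  obtain ⟨B, hB, hKB⟩ := exists_norm_primitive_truncatedKernel_le hφsmooth hφrange hφzero
  have hS : 0 ≤ ∑ j ∈ Finset.range N, A j := Finset.sum_nonneg fun j _ => hA0 j
  refine ⟨(∑ j ∈ Finset.range N, A j) * B + 1, by positivity, fun a ha R hR ε hε => ?_⟩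
  have hφc := hφsmooth.continuous
  have hfD : ∀ x ∈ Icc 0 L, ∀ y ∈ Icc 0 L,
      IntervalIntegrable (fun s => truncatedKernel φ a R ε (D s)) volume x y := by
    intro x hx y hy
    have hsub : uIoc x y ⊆ Icc 0 L :=
      uIoc_subset_uIcc.trans (ordConnected_Icc.uIcc_subset hx hy)
    refine (intervalIntegrable_const (c := 1 / ε)).mono_fun ?_
      (.of_forall fun s => (norm_truncatedKernel_le hφrange a R hε _).trans (le_abs_self _))
    exact ((measurable_truncatedKernel hφc a R ε).comp_aemeasurable
      ((hDc.mono hsub).aemeasurable measurableSet_uIoc)).aestronglyMeasurable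
  have hmeas : MeasurableSet {s ∈ Icc (0:ℝ) L | ε < |D s|} := by
    obtain ⟨u, hu, hu'⟩ := continuousOn_iff'.1 hDc.abs (Ioi ε) isOpen_Ioi
    have : {s ∈ Icc (0:ℝ) L | ε < |D s|} = u ∩ Icc 0 L := by
      rw [← hu', inter_comm]; rfl
    rw [this]
    exact hu.measurableSet.inter measurableSet_Icc
  have heq : ∫ s in {s ∈ Icc (0:ℝ) L | ε < |D s|},
      Complex.exp (-(Complex.I * a / (4 * D s))) * ((φ (D s / R) / |D s| : ℝ) : ℂ) =
      ∑ j ∈ Finset.range N, ∫ s in c j..c (j + 1), truncatedKernel φ a R ε (D s) := by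
    rw [intervalIntegral.sum_integral_adjacent_intervals
      fun j hj => hfD _ (hcI j hj.le) _ (hcI (j + 1) hj), hc0, hcN,
      intervalIntegral.integral_of_le hL.le, ← integral_Icc_eq_integral_Ioc,
      ← integral_indicator hmeas, ← integral_indicator measurableSet_Icc]
    congr 1
    ext s
    by_cases h1 : s ∈ Icc 0 L <;> by_cases h2 : ε < |D s| <;>
      simp [indicator, truncatedKernel, h1, h2, -mem_Icc]
  obtain ⟨b, hb⟩ := exists_lipschitzWith_primitive_truncatedKernel hφc hφrange a R hε
  rw [heq]
  calc _ ≤ ∑ j ∈ Finset.range N, A j * (B * (R / |a|)) :=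
        norm_sum_le_of_le _ fun j hj =>
          have hj := Finset.mem_range.1 hj
          hA j hj b _ _ ε _ hb
            (fun y hy => hasDerivAt_primitive_truncatedKernel hφc hφrange a R hε hy)
            (hKB a ha R hR ε hε) (hfD _ (hcI j hj.le) _ (hcI (j + 1) hj))
    _ = (∑ j ∈ Finset.range N, A j) * B * (R / |a|) := by rw [← Finset.sum_mul, mul_assoc]
    _ ≤ ((∑ j ∈ Finset.range N, A j) * B + 1) * (R / |a|) :=
        mul_le_mul_of_nonneg_right (by linarith) (by positivity)
    _ = _ := (mul_div_assoc _ _ _).symm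
end

section
/- Let F:ℝ→[0,∞) be symmetric (F(−x)=F(x)) and subadditive (F(x+y)≤F(x)+F(y) for all x,y∈ℝ). Then for all measurable h1,h2,h3,h4:ℝ→ℂ, one has K²(e^{F}h1, e^{−F}h2, e^{−F}h3, e^{−F}h4) ≤ K²(h1,h2,h3,h4), as an inequality in [0,∞]. -/
open MeasureTheory Set
open scoped ENNReal NNReal

/-- The resonance function on the hyperplane `η₄ = η₁ - η₂ + η₃`. -/
noncomputable def aFn (p : ℝ × ℝ × ℝ) : ℝ :=
  p.1 ^ 2 - p.2.1 ^ 2 + p.2.2 ^ 2 - (p.1 - p.2.1 + p.2.2) ^ 2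

/-- The multi-sub-linear functional `K²`. -/
noncomputable def K2 (L : ℝ) (D : ℝ → ℝ) (h1 h2 h3 h4 : ℝ → ℂ) : ℝ≥0∞ :=
  ∫⁻ p : ℝ × ℝ × ℝ,
    ENNReal.ofReal
        ((1 / L) * ‖∫ s in (0:ℝ)..L, Complex.exp (Complex.I * (D s) * (aFn p))‖) *
      ‖h1 p.1‖₊ * ‖h2 p.2.1‖₊ * ‖h3 p.2.2‖₊ * ‖h4 (p.1 - p.2.1 + p.2.2)‖₊

/-- Exponentially twisted bound: if `F ≥ 0` is symmetric and subadditive, then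
the twist `(e^F h1, e^{-F} h2, e^{-F} h3, e^{-F} h4)` does not increase `K²`. -/
theorem K2_exp_twisted_bound
    (L : ℝ) (hL : 0 < L) (d0 : ℝ → ℝ)
    (hd0int : IntegrableOn d0 (Icc 0 L))
    (D : ℝ → ℝ) (hD : ∀ s, D s = ∫ t in (0:ℝ)..s, d0 t)
    (F : ℝ → ℝ) (hF0 : ∀ x, 0 ≤ F x) (hFsym : ∀ x, F (-x) = F x)
    (hFsub : ∀ x y, F (x + y) ≤ F x + F y)
    (h1 h2 h3 h4 : ℝ → ℂ)
    (hm1 : Measurable h1) (hm2 : Measurable h2)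
    (hm3 : Measurable h3) (hm4 : Measurable h4) :
    K2 L D (fun x => (Real.exp (F x) : ℂ) * h1 x)
      (fun x => (Real.exp (-F x) : ℂ) * h2 x)
      (fun x => (Real.exp (-F x) : ℂ) * h3 x)
      (fun x => (Real.exp (-F x) : ℂ) * h4 x)
      ≤ K2 L D h1 h2 h3 h4 := by
  refine lintegral_mono fun p => ?_
  have htri : F p.1 ≤ F p.2.1 + F p.2.2 + F (p.1 - p.2.1 + p.2.2) := by
    have hsplit := hFsub (p.1 - p.2.1 + p.2.2) (p.2.1 + -p.2.2)
    have hsub := hFsub p.2.1 (-p.2.2)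
    rw [hFsym] at hsub
    rw [show p.1 - p.2.1 + p.2.2 + (p.2.1 + -p.2.2) = p.1 by ring] at hsplit
    linarith
  have hprod : ‖(Real.exp (F p.1) : ℂ) * h1 p.1‖₊ * ‖(Real.exp (-F p.2.1) : ℂ) * h2 p.2.1‖₊ *
      ‖(Real.exp (-F p.2.2) : ℂ) * h3 p.2.2‖₊ *
      ‖(Real.exp (-F (p.1 - p.2.1 + p.2.2)) : ℂ) * h4 (p.1 - p.2.1 + p.2.2)‖₊ ≤
      ‖h1 p.1‖₊ * ‖h2 p.2.1‖₊ * ‖h3 p.2.2‖₊ * ‖h4 (p.1 - p.2.1 + p.2.2)‖₊ := by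
    rw [← NNReal.coe_le_coe]
    push_cast
    simp only [norm_mul, ← Complex.ofReal_neg, Complex.norm_exp_ofReal]
    calc _ = Real.exp (F p.1 + -F p.2.1 + -F p.2.2 + -F (p.1 - p.2.1 + p.2.2)) *
          (‖h1 p.1‖ * ‖h2 p.2.1‖ * ‖h3 p.2.2‖ * ‖h4 (p.1 - p.2.1 + p.2.2)‖) := by
          simp only [Real.exp_add]
          ring
      _ ≤ _ := mul_le_of_le_one_left (by positivity) (Real.exp_le_one_iff.mpr (by linarith))
  simp only [mul_assoc] at hprod ⊢
  exact mul_le_mul_right (mod_cast hprod) _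
end

section
/- Let ξ:ℝ→ℝ be a smooth function such that ξ and ξ' are bounded, and let f:ℝ→ℂ be smooth and compactly supported. Then Re ∫_ℝ conj((ξ²f)'(x)) · f'(x) dx = ∫_ℝ |(ξf)'(x)|² dx − ∫_ℝ ξ'(x)² |f(x)|² dx, where (ξ²f)(x)=ξ(x)²f(x) and (ξf)(x)=ξ(x)f(x). -/
open MeasureTheory

/-- The pointwise identity behind the IMS localization formula. -/
theorem re_conj_deriv_sq_mul_mul_deriv {ξ : ℝ → ℝ} {f : ℝ → ℂ} {x : ℝ}
    (hξ : DifferentiableAt ℝ ξ x) (hf : DifferentiableAt ℝ f x) :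
    ((starRingEnd ℂ) (deriv (fun y => ((ξ y : ℂ)) ^ 2 * f y) x) * deriv f x).re
      = ‖deriv (fun y => (ξ y : ℂ) * f y) x‖ ^ 2 - (deriv ξ x) ^ 2 * ‖f x‖ ^ 2 := by
  have hξ' := hξ.hasDerivAt.ofReal_comp
  have h₁ := (hξ'.mul hf.hasDerivAt).deriv
  have h₂ := ((hξ'.pow 2).mul hf.hasDerivAt).deriv
  simp only [Pi.mul_def, Pi.pow_apply] at h₁ h₂
  rw [h₁, h₂]
  simp only [← Complex.normSq_eq_norm_sq, Complex.normSq_apply]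
  simp [pow_two]
  ring

/-- One-dimensional IMS localization formula:
`Re ⟨(ξ²f)', f'⟩ = ‖(ξf)'‖² − ⟨f, |ξ'|² f⟩`. -/
theorem ims_localization
    (ξ : ℝ → ℝ) (hξ : ContDiff ℝ (⊤ : ℕ∞) ξ)
    (hξbdd : ∃ M : ℝ, ∀ x, |ξ x| ≤ M) (hξ'bdd : ∃ M : ℝ, ∀ x, |deriv ξ x| ≤ M)
    (f : ℝ → ℂ) (hf : ContDiff ℝ (⊤ : ℕ∞) f) (hfc : HasCompactSupport f) :
    (∫ x : ℝ, (starRingEnd ℂ) (deriv (fun y => ((ξ y : ℂ)) ^ 2 * f y) x) * deriv f x).re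
      = (∫ x : ℝ, ‖deriv (fun y => (ξ y : ℂ) * f y) x‖ ^ 2)
        - ∫ x : ℝ, (deriv ξ x) ^ 2 * ‖f x‖ ^ 2 := by
  have hξc : ContDiff ℝ (⊤ : ℕ∞) (fun y => (ξ y : ℂ)) := Complex.ofRealCLM.contDiff.comp hξ
  have hn : ((⊤ : ℕ∞) : WithTop ℕ∞) ≠ 0 := by simp
  have h1 : (1 : WithTop ℕ∞) ≤ ((⊤ : ℕ∞) : WithTop ℕ∞) := by exact_mod_cast le_top
  have hint₁ : Integrable
      (fun x => (starRingEnd ℂ) (deriv (fun y => ((ξ y : ℂ)) ^ 2 * f y) x) * deriv f x) :=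
    ((Complex.continuous_conj.comp (((hξc.pow 2).mul hf).continuous_deriv h1)).mul
      (hf.continuous_deriv h1)).integrable_of_hasCompactSupport hfc.deriv.mul_left
  have hint₂ : Integrable (fun x => ‖deriv (fun y => (ξ y : ℂ) * f y) x‖ ^ 2) := by
    have hs : HasCompactSupport (deriv (fun y => (ξ y : ℂ) * f y)) :=
      (HasCompactSupport.mul_left hfc).deriv
    have hs' : HasCompactSupport (fun x => ‖deriv (fun y => (ξ y : ℂ) * f y) x‖ ^ 2) :=
      hs.comp_left (g := fun z : ℂ => ‖z‖ ^ 2) (by simp)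
    have hc : Continuous (deriv (fun y => (ξ y : ℂ) * f y)) := (hξc.mul hf).continuous_deriv h1
    exact (hc.norm.pow 2).integrable_of_hasCompactSupport hs'
  have hint₃ : Integrable (fun x => (deriv ξ x) ^ 2 * ‖f x‖ ^ 2) := by
    have hs : HasCompactSupport (fun x => ‖f x‖ ^ 2) :=
      hfc.comp_left (g := fun z : ℂ => ‖z‖ ^ 2) (by simp)
    have hc : Continuous (deriv ξ) := hξ.continuous_deriv h1
    exact ((hc.pow 2).mul (hf.continuous.norm.pow 2)).integrable_of_hasCompactSupport hs.mul_left
  rw [← integral_sub hint₂ hint₃]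
  refine (integral_re hint₁).symm.trans (integral_congr_ae (.of_forall fun x => ?_))
  exact re_conj_deriv_sq_mul_mul_deriv (hξ.differentiable hn x) (hf.differentiable hn x)
end

section
/- For all Schwartz functions f1,f2,f3,f4:ℝ→ℂ one has (1/L)·∫₀^L ∫_ℝ conj(T_{D(s)}f1(x)) · T_{D(s)}f2(x) · conj(T_{D(s)}f3(x)) · T_{D(s)}f4(x) dx ds = (1/(2πL))·∫_{ℝ³} (∫₀^L e^{i D(s) a(η)} ds) · conj(f̂1(η1)) · f̂2(η2) · conj(f̂3(η3)) · f̂4(η1−η2+η3) dη1 dη2 dη3. -/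
open MeasureTheory Set

/-- The Fourier transform `ĝ(k) = (2π)^{-1/2} ∫ e^{ikx} g(x) dx`. -/
noncomputable def ft (g : ℝ → ℂ) (k : ℝ) : ℂ :=
  ((Real.sqrt (2 * Real.pi) : ℂ))⁻¹ * ∫ x : ℝ, Complex.exp (Complex.I * k * x) * g x

/-- The free Schrödinger evolution
`T_r g(x) = (2π)^{-1/2} ∫ e^{-ixk} e^{-irk²} ĝ(k) dk`, i.e. `T_r = e^{ir∂ₓ²}`. -/
noncomputable def Tevol (r : ℝ) (g : ℝ → ℂ) (x : ℝ) : ℂ :=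
  ((Real.sqrt (2 * Real.pi) : ℂ))⁻¹ *
    ∫ k : ℝ, Complex.exp (-(Complex.I * x * k)) *
      Complex.exp (-(Complex.I * r * k ^ 2)) * ft g k

open scoped FourierTransform SchwartzMap ContDiff

/-- The function `t ↦ e^{it}` has temperate growth. -/
theorem hasTemperateGrowth_cexp_I_mul :
    Function.HasTemperateGrowth (fun t : ℝ ↦ Complex.exp (Complex.I * t)) := by
  refine ⟨(contDiff_const.mul Complex.ofRealCLM.contDiff).cexp, fun n ↦ ⟨0, 1, fun x ↦ ?_⟩⟩
  have key : ∀ m : ℕ, iteratedDeriv m (fun t : ℝ ↦ Complex.exp (Complex.I * t)) =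
      fun t : ℝ ↦ Complex.I ^ m * Complex.exp (Complex.I * t) := by
    intro m
    induction m with
    | zero => simp
    | succ m ih =>
      rw [iteratedDeriv_succ, ih]
      ext t
      have h1 : HasDerivAt (fun t : ℝ ↦ Complex.I * (t : ℂ)) Complex.I t := by
        simpa using (Complex.ofRealCLM.hasDerivAt (x := t)).const_mul Complex.I
      rw [(h1.cexp.const_mul (Complex.I ^ m)).deriv]
      ring
  rw [norm_iteratedFDeriv_eq_norm_iteratedDeriv, key]
  simp [mul_comm Complex.I, Complex.norm_exp_ofReal_mul_I]

/-- Multiplication by the Schrödinger phase `e^{-irk²}` preserves the Schwartz space. -/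
theorem SchwartzMap.exists_schrodinger_phase_mul (r : ℝ) (S : 𝓢(ℝ, ℂ)) :
    ∃ G : 𝓢(ℝ, ℂ), ∀ k : ℝ, G k = Complex.exp (-(Complex.I * r * k ^ 2)) * S k := by
  have hg : Function.HasTemperateGrowth
      (fun k : ℝ ↦ Complex.exp (-(Complex.I * r * k ^ 2))) := by
    have hpoly : Function.HasTemperateGrowth (fun k : ℝ ↦ -r * k ^ 2) := by
      have := (Function.HasTemperateGrowth.id (E := ℝ)).pow 2
      exact (Function.HasTemperateGrowth.const (-r)).mul this
    convert hasTemperateGrowth_cexp_I_mul.comp hpoly using 1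
    ext k
    simp only [Function.comp_apply]
    push_cast
    ring_nf
  exact ⟨SchwartzMap.smulLeftCLM ℂ _ S, fun k ↦ by
    rw [SchwartzMap.smulLeftCLM_apply_apply hg, smul_eq_mul]⟩

/-- Dilation by a nonzero factor preserves the Schwartz space. -/
theorem SchwartzMap.exists_dilation (S : 𝓢(ℝ, ℂ)) {a : ℝ} (ha : a ≠ 0) :
    ∃ G : 𝓢(ℝ, ℂ), ∀ k : ℝ, G k = S (k * a) :=
  ⟨SchwartzMap.compCLMOfContinuousLinearEquiv ℂ
    (ContinuousLinearEquiv.unitsEquivAut ℝ (Units.mk0 a ha)) S, fun k ↦ by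
    simp [SchwartzMap.compCLMOfContinuousLinearEquiv_apply]⟩

/-- `ft` in terms of Mathlib's inverse Fourier transform. -/
theorem ft_eq_fourierInv (g : ℝ → ℂ) (k : ℝ) :
    ft g k = ((Real.sqrt (2 * Real.pi) : ℂ))⁻¹ * 𝓕⁻ g (k * (2 * Real.pi)⁻¹) := by
  have hpi : (Real.pi : ℂ) ≠ 0 := by exact_mod_cast Real.pi_ne_zero
  rw [ft, Real.fourierInv_eq']
  congr 2 with x
  rw [smul_eq_mul]
  congr 2
  simp only [RCLike.inner_apply, conj_trivial]
  push_cast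
  field_simp

/-- The Fourier transform of a Schwartz function is a Schwartz function. -/
theorem SchwartzMap.exists_coe_eq_ft (f : 𝓢(ℝ, ℂ)) : ∃ G : 𝓢(ℝ, ℂ), ⇑G = ft f := by
  obtain ⟨G, hG⟩ := (𝓕⁻ f).exists_dilation (a := (2 * Real.pi)⁻¹) (by positivity)
  refine ⟨((Real.sqrt (2 * Real.pi) : ℂ))⁻¹ • G, ?_⟩
  ext k
  rw [ft_eq_fourierInv, smul_apply, hG, SchwartzMap.fourierInv_coe, smul_eq_mul]

/-- Fourier inversion: the inverse transform of a Schwartz function `S` is a Schwartz function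
whose Fourier transform is `S`. -/
theorem SchwartzMap.exists_ft_eq (S : 𝓢(ℝ, ℂ)) :
    ∃ U : 𝓢(ℝ, ℂ), (∀ x : ℝ, U x = ((Real.sqrt (2 * Real.pi) : ℂ))⁻¹ *
      ∫ k : ℝ, Complex.exp (-(Complex.I * x * k)) * S k) ∧ ft U = S := by
  have hpi : (Real.pi : ℂ) ≠ 0 := by exact_mod_cast Real.pi_ne_zero
  have hc : (Real.sqrt (2 * Real.pi) : ℂ) ≠ 0 := by
    exact_mod_cast (Real.sqrt_pos.2 (by positivity)).ne'
  have hc2 : (Real.sqrt (2 * Real.pi) : ℂ) ^ 2 = 2 * Real.pi := by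
    exact_mod_cast Real.sq_sqrt (by positivity : (0 : ℝ) ≤ 2 * Real.pi)
  obtain ⟨G, hG⟩ := (𝓕 S).exists_dilation (a := (2 * Real.pi)⁻¹) (by positivity)
  refine ⟨((Real.sqrt (2 * Real.pi) : ℂ))⁻¹ • G, fun x ↦ ?_, ?_⟩
  · rw [smul_apply, hG, SchwartzMap.fourier_coe, smul_eq_mul,
      Real.fourier_real_eq_integral_exp_smul]
    congr 2 with k
    rw [smul_eq_mul]
    congr 2
    push_cast
    field_simp
  · ext η
    have hinv : 𝓕⁻ (𝓕 S) η = S η := by simp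
    rw [SchwartzMap.fourierInv_coe, Real.fourierInv_eq'] at hinv
    have hscale := Measure.integral_comp_div
      (fun v : ℝ ↦ Complex.exp (((2 * Real.pi * inner ℝ v η : ℝ) : ℂ) * Complex.I) • (𝓕 S) v)
      (2 * Real.pi)
    rw [hinv, abs_of_pos (by positivity)] at hscale
    have hint : ∫ x : ℝ, Complex.exp (Complex.I * η * x) *
        (((Real.sqrt (2 * Real.pi) : ℂ))⁻¹ • G) x =
        ((Real.sqrt (2 * Real.pi) : ℂ))⁻¹ * ((2 * Real.pi : ℝ) • S η) := by
      rw [← hscale, ← integral_const_mul]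
      congr 1 with x
      rw [smul_apply, hG, smul_eq_mul, smul_eq_mul, ← div_eq_mul_inv]
      have : Complex.I * η * x =
          ((2 * Real.pi * inner ℝ (x / (2 * Real.pi)) η : ℝ) : ℂ) * Complex.I := by
        simp only [RCLike.inner_apply, conj_trivial]
        push_cast
        field_simp
      rw [this]
      ring
    rw [ft, hint, Complex.real_smul]
    push_cast
    rw [← hc2]
    field_simp

/-- The tensor product of three Schwartz functions is integrable. -/
theorem SchwartzMap.integrable_conj_mul_mul_conj (S₁ S₂ S₃ : 𝓢(ℝ, ℂ)) :
    Integrable (fun p : ℝ × ℝ × ℝ ↦ (starRingEnd ℂ) (S₁ p.1) *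
      (S₂ p.2.1 * (starRingEnd ℂ) (S₃ p.2.2))) := by
  have hconj : ∀ S : 𝓢(ℝ, ℂ), Integrable (fun x : ℝ ↦ (starRingEnd ℂ) (S x)) := fun S ↦
    (Complex.conjLIE.toContinuousLinearEquiv : ℂ →L[ℝ] ℂ).integrable_comp S.integrable
  exact (hconj S₁).mul_prod (S₂.integrable.mul_prod (hconj S₃))

/-- Integral of a product of four inverse Fourier transforms, in Fourier variables. -/
theorem integral_conj_mul_mul_conj_mul (S₁ S₂ S₃ U : 𝓢(ℝ, ℂ)) :
    ∫ x : ℝ, (starRingEnd ℂ) (((Real.sqrt (2 * Real.pi) : ℂ))⁻¹ *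
          ∫ k : ℝ, Complex.exp (-(Complex.I * x * k)) * S₁ k) *
        (((Real.sqrt (2 * Real.pi) : ℂ))⁻¹ *
          ∫ k : ℝ, Complex.exp (-(Complex.I * x * k)) * S₂ k) *
        (starRingEnd ℂ) (((Real.sqrt (2 * Real.pi) : ℂ))⁻¹ *
          ∫ k : ℝ, Complex.exp (-(Complex.I * x * k)) * S₃ k) * U x =
      (2 * Real.pi : ℂ)⁻¹ * ∫ p : ℝ × ℝ × ℝ, (starRingEnd ℂ) (S₁ p.1) * S₂ p.2.1 *
        (starRingEnd ℂ) (S₃ p.2.2) * ft U (p.1 - p.2.1 + p.2.2) := by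
  have hc2 : (Real.sqrt (2 * Real.pi) : ℂ) ^ 2 = 2 * Real.pi := by
    exact_mod_cast Real.sq_sqrt (by positivity : (0 : ℝ) ≤ 2 * Real.pi)
  set c : ℂ := ((Real.sqrt (2 * Real.pi) : ℂ))⁻¹ with hc
  have hconjc : (starRingEnd ℂ) c = c := by simp [hc]
  have hcc : c ^ 2 = (2 * Real.pi : ℂ)⁻¹ := by rw [hc, inv_pow, hc2]
  have hconj : ∀ (S : 𝓢(ℝ, ℂ)) (x : ℝ),
      (starRingEnd ℂ) (c * ∫ k : ℝ, Complex.exp (-(Complex.I * x * k)) * S k) =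
      c * ∫ k : ℝ, Complex.exp (Complex.I * x * k) * (starRingEnd ℂ) (S k) := by
    intro S x
    rw [map_mul, hconjc, ← integral_conj]
    simp [← Complex.exp_conj]
  set Φ : ℝ → ℝ × ℝ × ℝ → ℂ := fun x p ↦
    Complex.exp (Complex.I * ((p.1 - p.2.1 + p.2.2 : ℝ) : ℂ) * x) *
      (U x * ((starRingEnd ℂ) (S₁ p.1) * (S₂ p.2.1 * (starRingEnd ℂ) (S₃ p.2.2)))) with hΦ
  have hΦint : Integrable (Function.uncurry Φ) (volume.prod volume) := by
    refine Integrable.bdd_mul (c := 1)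
      (U.integrable.mul_prod (SchwartzMap.integrable_conj_mul_mul_conj S₁ S₂ S₃)) ?_ ?_
    · exact Continuous.aestronglyMeasurable (by fun_prop)
    · refine Filter.Eventually.of_forall fun z ↦ le_of_eq ?_
      have : Complex.I * ((z.2.1 - z.2.2.1 + z.2.2.2 : ℝ) : ℂ) * z.1 =
          (((z.2.1 - z.2.2.1 + z.2.2.2) * z.1 : ℝ) : ℂ) * Complex.I := by
        push_cast
        ring
      rw [this, Complex.norm_exp_ofReal_mul_I]
  have hleft : ∀ x : ℝ, (starRingEnd ℂ) (c *
          ∫ k : ℝ, Complex.exp (-(Complex.I * x * k)) * S₁ k) *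
        (c * ∫ k : ℝ, Complex.exp (-(Complex.I * x * k)) * S₂ k) *
        (starRingEnd ℂ) (c * ∫ k : ℝ, Complex.exp (-(Complex.I * x * k)) * S₃ k) * U x =
      c ^ 3 * ∫ p, Φ x p := by
    intro x
    rw [hconj, hconj]
    have hprod : ∫ p, Φ x p = U x *
        ((∫ k : ℝ, Complex.exp (Complex.I * x * k) * (starRingEnd ℂ) (S₁ k)) *
        ((∫ k : ℝ, Complex.exp (-(Complex.I * x * k)) * S₂ k) *
        ∫ k : ℝ, Complex.exp (Complex.I * x * k) * (starRingEnd ℂ) (S₃ k))) := by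
      rw [← integral_prod_mul, ← integral_prod_mul, ← integral_const_mul]
      congr 1 with p
      have : Complex.exp (Complex.I * ((p.1 - p.2.1 + p.2.2 : ℝ) : ℂ) * x) =
          Complex.exp (Complex.I * x * p.1) * (Complex.exp (-(Complex.I * x * p.2.1)) *
            Complex.exp (Complex.I * x * p.2.2)) := by
        rw [← Complex.exp_add, ← Complex.exp_add]
        push_cast
        ring_nf
      simp only [hΦ, this]
      ring
    rw [hprod]
    ring
  simp_rw [hleft]
  rw [integral_const_mul, integral_integral_swap hΦint, ← hcc, ← integral_const_mul,
    ← integral_const_mul]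
  congr 1 with p
  have hinner : ∫ x, Φ x p = ((starRingEnd ℂ) (S₁ p.1) * (S₂ p.2.1 * (starRingEnd ℂ) (S₃ p.2.2))) *
      ∫ x : ℝ, Complex.exp (Complex.I * ((p.1 - p.2.1 + p.2.2 : ℝ) : ℂ) * x) * U x := by
    rw [← integral_const_mul]
    congr 1 with x
    simp only [hΦ]
    ring
  rw [hinner, ft, ← hc]
  ring

/-- The spatial integral at a fixed time `r`, in Fourier variables. -/
theorem integral_Tevol_eq (r : ℝ) (f₁ f₂ f₃ f₄ : 𝓢(ℝ, ℂ)) :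
    ∫ x : ℝ, (starRingEnd ℂ) (Tevol r f₁ x) * Tevol r f₂ x *
          (starRingEnd ℂ) (Tevol r f₃ x) * Tevol r f₄ x =
      (2 * Real.pi : ℂ)⁻¹ * ∫ p : ℝ × ℝ × ℝ, Complex.exp (Complex.I * r * (aFn p)) *
        ((starRingEnd ℂ) (ft f₁ p.1) * ft f₂ p.2.1 *
          (starRingEnd ℂ) (ft f₃ p.2.2) * ft f₄ (p.1 - p.2.1 + p.2.2)) := by
  have hG : ∀ f : 𝓢(ℝ, ℂ), ∃ G : 𝓢(ℝ, ℂ),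
      ∀ k : ℝ, G k = Complex.exp (-(Complex.I * r * k ^ 2)) * ft f k := by
    intro f
    obtain ⟨F, hF⟩ := f.exists_coe_eq_ft
    rw [← hF]
    exact F.exists_schrodinger_phase_mul r
  obtain ⟨G₁, h₁⟩ := hG f₁
  obtain ⟨G₂, h₂⟩ := hG f₂
  obtain ⟨G₃, h₃⟩ := hG f₃
  obtain ⟨G₄, h₄⟩ := hG f₄
  obtain ⟨U, hU, hUft⟩ := G₄.exists_ft_eq
  have hT : ∀ f G : 𝓢(ℝ, ℂ), (∀ k : ℝ, G k = Complex.exp (-(Complex.I * r * k ^ 2)) * ft f k) →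
      ∀ x, Tevol r f x = ((Real.sqrt (2 * Real.pi) : ℂ))⁻¹ *
        ∫ k : ℝ, Complex.exp (-(Complex.I * x * k)) * G k := by
    intro f G h x
    simp only [Tevol, h, mul_assoc]
  simp_rw [hT f₁ G₁ h₁, hT f₂ G₂ h₂, hT f₃ G₃ h₃, hT f₄ G₄ h₄, ← hU]
  rw [integral_conj_mul_mul_conj_mul, hUft]
  congr 2 with p
  have hphase : Complex.exp (Complex.I * r * (aFn p)) =
      Complex.exp (Complex.I * r * p.1 ^ 2) * Complex.exp (-(Complex.I * r * p.2.1 ^ 2)) *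
      Complex.exp (Complex.I * r * p.2.2 ^ 2) *
      Complex.exp (-(Complex.I * r * ((p.1 - p.2.1 + p.2.2 : ℝ) : ℂ) ^ 2)) := by
    rw [← Complex.exp_add, ← Complex.exp_add, ← Complex.exp_add, aFn]
    push_cast
    ring_nf
  have hconj : ∀ k : ℝ, (starRingEnd ℂ) (Complex.exp (-(Complex.I * r * k ^ 2))) =
      Complex.exp (Complex.I * r * k ^ 2) := by
    intro k
    simp [← Complex.exp_conj]
  rw [h₁, h₂, h₃, h₄, map_mul, map_mul, hconj, hconj, hphase]
  ring

/-- The frequency-side integrand is integrable. -/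
theorem integrable_conj_ft_mul (f₁ f₂ f₃ f₄ : 𝓢(ℝ, ℂ)) :
    Integrable (fun p : ℝ × ℝ × ℝ ↦ (starRingEnd ℂ) (ft f₁ p.1) * ft f₂ p.2.1 *
      (starRingEnd ℂ) (ft f₃ p.2.2) * ft f₄ (p.1 - p.2.1 + p.2.2)) := by
  obtain ⟨F₁, h₁⟩ := f₁.exists_coe_eq_ft
  obtain ⟨F₂, h₂⟩ := f₂.exists_coe_eq_ft
  obtain ⟨F₃, h₃⟩ := f₃.exists_coe_eq_ft
  obtain ⟨F₄, h₄⟩ := f₄.exists_coe_eq_ft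
  rw [← h₁, ← h₂, ← h₃, ← h₄]
  refine (Integrable.bdd_mul (f := fun p : ℝ × ℝ × ℝ ↦ F₄ (p.1 - p.2.1 + p.2.2))
    (c := ‖F₄.toBoundedContinuousFunction‖)
    (SchwartzMap.integrable_conj_mul_mul_conj F₁ F₂ F₃) ?_ ?_).congr ?_
  · exact (F₄.continuous.comp (by fun_prop)).aestronglyMeasurable
  · exact Filter.Eventually.of_forall fun p ↦
      F₄.toBoundedContinuousFunction.norm_coe_le_norm _
  · exact Filter.Eventually.of_forall fun p ↦ by ring

/-- Fourier space representation of the four-linear functional `𝒬`. -/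
theorem Q_fourier_representation
    (L : ℝ) (hL : 0 < L) (d0 : ℝ → ℝ)
    (hd0int : IntegrableOn d0 (Icc 0 L))
    (D : ℝ → ℝ) (hD : ∀ s, D s = ∫ t in (0:ℝ)..s, d0 t)
    (f1 f2 f3 f4 : SchwartzMap ℝ ℂ) :
    ((1 / L : ℝ) : ℂ) * ∫ s in (0:ℝ)..L, ∫ x : ℝ,
        (starRingEnd ℂ) (Tevol (D s) (⇑f1) x) * Tevol (D s) (⇑f2) x *
          (starRingEnd ℂ) (Tevol (D s) (⇑f3) x) * Tevol (D s) (⇑f4) x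
      = ((1 / (2 * Real.pi * L) : ℝ) : ℂ) * ∫ p : ℝ × ℝ × ℝ,
          (∫ s in (0:ℝ)..L, Complex.exp (Complex.I * (D s) * (aFn p))) *
            (starRingEnd ℂ) (ft (⇑f1) p.1) * ft (⇑f2) p.2.1 *
            (starRingEnd ℂ) (ft (⇑f3) p.2.2) * ft (⇑f4) (p.1 - p.2.1 + p.2.2) := by
  set h : ℝ × ℝ × ℝ → ℂ := fun p ↦ (starRingEnd ℂ) (ft f1 p.1) * ft f2 p.2.1 *
    (starRingEnd ℂ) (ft f3 p.2.2) * ft f4 (p.1 - p.2.1 + p.2.2) with hh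
  have hDcont : ContinuousOn D (Icc 0 L) := by
    rw [funext hD, ← uIcc_of_le hL.le]
    exact intervalIntegral.continuousOn_primitive_interval (by rwa [uIcc_of_le hL.le])
  have hDmeas : AEStronglyMeasurable D (volume.restrict (Ioc 0 L)) :=
    (hDcont.mono Ioc_subset_Icc_self).aestronglyMeasurable measurableSet_Ioc
  have hint : Integrable (Function.uncurry fun (s : ℝ) (p : ℝ × ℝ × ℝ) ↦
      Complex.exp (Complex.I * (D s) * (aFn p)) * h p)
      ((volume.restrict (Ioc 0 L)).prod volume) := by
    refine Integrable.bdd_mul (c := 1)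
      ((integrable_conj_ft_mul f1 f2 f3 f4).comp_snd (volume.restrict (Ioc 0 L))) ?_ ?_
    · have haFn : Continuous aFn := by
        unfold aFn
        fun_prop
      refine Complex.continuous_exp.comp_aestronglyMeasurable ?_
      refine ((Complex.continuous_ofReal.comp_aestronglyMeasurable
        hDmeas.comp_fst).const_mul _).mul ?_
      exact (Complex.continuous_ofReal.comp (haFn.comp continuous_snd)).aestronglyMeasurable
    · refine Filter.Eventually.of_forall fun z ↦ le_of_eq ?_
      have : Complex.I * (D z.1) * (aFn z.2) = ((D z.1 * aFn z.2 : ℝ) : ℂ) * Complex.I := by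
        push_cast
        ring
      rw [this, Complex.norm_exp_ofReal_mul_I]
  have hright : ∀ p : ℝ × ℝ × ℝ,
      (∫ s in (0:ℝ)..L, Complex.exp (Complex.I * (D s) * (aFn p))) *
        (starRingEnd ℂ) (ft f1 p.1) * ft f2 p.2.1 *
        (starRingEnd ℂ) (ft f3 p.2.2) * ft f4 (p.1 - p.2.1 + p.2.2) =
      ∫ s in Ioc 0 L, Complex.exp (Complex.I * (D s) * (aFn p)) * h p := by
    intro p
    rw [integral_mul_const, ← intervalIntegral.integral_of_le hL.le]
    simp only [hh]
    ring
  simp_rw [integral_Tevol_eq, hright]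
  rw [intervalIntegral.integral_const_mul, intervalIntegral.integral_of_le hL.le,
    integral_integral_swap hint]
  push_cast
  have hpi : (Real.pi : ℂ) ≠ 0 := by exact_mod_cast Real.pi_ne_zero
  have hL' : (L : ℂ) ≠ 0 := by exact_mod_cast hL.ne'
  field_simp
end
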